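/- arXiv:1804.10556 — 2 statements merged into one kernel-verified Lean document; each statement's English description precedes it below -/
import Mathlib

section
/- Let X_1,...,X_n be independent random elements in spaces X_1,...,X_n, and f a real-valued integrable function of (X_1,...,X_n). Let X_i' be an independent copy of X_i and D_i = f(X) − f(X with the i-th coordinate replaced by X_i'). Suppose there exist constants σ_i > 0 and M > 0 such that almost surely, for every integer k ≥ 2, E(|D_i|^k | X_{−i}) ≤ (1/2)σ_i² k! M^{k−2}. Then for all t > 0, P(f(X) − E f(X) ≥ t) ≤ exp(−t²/(2σ² + 2tM)), where σ² = ∑_{i=1}^n σ_i². -/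
open MeasureTheory

lemma lint_top_of_not {Y : Type*} [MeasurableSpace Y] (ν : Measure Y)
    (F : Y → ℝ) (hF : Measurable F) (h0 : ∀ b, 0 ≤ F b) (h : ¬ Integrable F ν) :
    ∫⁻ b, ENNReal.ofReal (F b) ∂ν = ⊤ := by
  by_contra hne
  exact h ⟨hF.aestronglyMeasurable, by
    rw [hasFiniteIntegral_iff_ofReal (Filter.Eventually.of_forall h0)]
    exact lt_top_iff_ne_top.mpr hne⟩

lemma jensen_exp {Y : Type*} [MeasurableSpace Y] (ν : Measure Y) [IsProbabilityMeasure ν]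
    (u : Y → ℝ) (hu : Measurable u) (hi : Integrable u ν) :
    ENNReal.ofReal (Real.exp (∫ b, u b ∂ν)) ≤ ∫⁻ b, ENNReal.ofReal (Real.exp (u b)) ∂ν := by
  by_cases h : Integrable (fun b => Real.exp (u b)) ν
  · rw [← ofReal_integral_eq_lintegral_ofReal h
      (Filter.Eventually.of_forall fun b => (Real.exp_pos _).le)]
    apply ENNReal.ofReal_le_ofReal
    exact convexOn_exp.map_integral_le Real.continuous_exp.continuousOn isClosed_univ
      (by simp) hi h
  · rw [lint_top_of_not ν _ (by fun_prop) (fun b => (Real.exp_pos _).le) h]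
    exact le_top

lemma jensen_pow {Y : Type*} [MeasurableSpace Y] (ν : Measure Y) [IsProbabilityMeasure ν]
    (u : Y → ℝ) (hu : Measurable u) (hi : Integrable u ν) (k : ℕ) :
    ENNReal.ofReal (|∫ b, u b ∂ν| ^ k) ≤ ∫⁻ b, ENNReal.ofReal (|u b| ^ k) ∂ν := by
  have hpos : ∀ b, 0 ≤ |u b| ^ k := fun b => by positivity
  by_cases h : Integrable (fun b => |u b| ^ k) ν
  · rw [← ofReal_integral_eq_lintegral_ofReal h
      (Filter.Eventually.of_forall hpos)]
    apply ENNReal.ofReal_le_ofReal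
    calc |∫ b, u b ∂ν| ^ k ≤ (∫ b, |u b| ∂ν) ^ k := by
          gcongr
          exact abs_integral_le_integral_abs
      _ ≤ _ := (convexOn_pow k).map_integral_le (by fun_prop) isClosed_Ici
          (Filter.Eventually.of_forall fun b => abs_nonneg (u b)) hi.abs h
  · rw [lint_top_of_not ν _ (by fun_prop) hpos h]
    exact le_top

lemma exp_series_bound (y : ℝ) :
    ENNReal.ofReal (Real.exp y) + ENNReal.ofReal (Real.exp (-y))
      ≤ 2 * (1 + ∑' k : ℕ, ENNReal.ofReal (|y| ^ (k + 2) / (Nat.factorial (k + 2)))) := by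
  have hs : HasSum (fun n : ℕ => |y| ^ n / (Nat.factorial n : ℝ)) (Real.exp |y|) := by
    rw [Real.exp_eq_exp_ℝ]; exact NormedSpace.expSeries_div_hasSum_exp |y|
  have hs2 := (hasSum_nat_add_iff' 2).mpr hs
  have h0 : ∀ k : ℕ, 0 ≤ |y| ^ (k + 2) / (Nat.factorial (k + 2) : ℝ) := fun k => by positivity
  rw [← ENNReal.ofReal_tsum_of_nonneg h0 hs2.summable, hs2.tsum_eq,
    ← ENNReal.ofReal_add (Real.exp_pos _).le (Real.exp_pos _).le]
  have hnn : 0 ≤ Real.exp |y| - ∑ i ∈ Finset.range 2, |y| ^ i / (Nat.factorial i : ℝ) :=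
    hs2.nonneg h0
  have h2 : (2 : ENNReal) = ENNReal.ofReal 2 := by simp
  have h1 : (1 : ENNReal) = ENNReal.ofReal 1 := by simp
  rw [h2, h1, ← ENNReal.ofReal_add zero_le_one hnn, ← ENNReal.ofReal_mul (by norm_num)]
  apply ENNReal.ofReal_le_ofReal
  simp only [Finset.sum_range_succ, Finset.sum_range_zero, Nat.factorial]
  have hc : Real.exp y + Real.exp (-y) = Real.exp |y| + Real.exp (-|y|) := by
    rcases abs_cases y with ⟨h, _⟩ | ⟨h, _⟩ <;> rw [h] <;> simp [add_comm]
  have hsinh := Real.self_le_sinh_iff.mpr (abs_nonneg y)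
  rw [Real.sinh_eq] at hsinh
  rw [hc]
  norm_num
  linarith

lemma one_coord {Y : Type*} [MeasurableSpace Y] (ν : Measure Y) [IsProbabilityMeasure ν]
    (h : Y → ℝ) (hm : Measurable h) (hi : Integrable h ν) (s M l : ℝ) (hM : 0 < M)
    (hl : 0 < l) (hlM : l * M < 1)
    (hb : ∀ k : ℕ, 2 ≤ k → ∫⁻ a, ∫⁻ b, ENNReal.ofReal (|h a - h b| ^ k) ∂ν ∂ν
      ≤ ENNReal.ofReal ((1/2) * s^2 * (Nat.factorial k) * M ^ (k - 2))) :
    ∫⁻ a, ENNReal.ofReal (Real.exp (l * (h a - ∫ b, h b ∂ν))) ∂ν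
      ≤ ENNReal.ofReal (Real.exp (l^2 * s^2 / (2 * (1 - l * M)))) := by
  have e1 : ∀ a, ENNReal.ofReal (Real.exp (l * (h a - ∫ b, h b ∂ν)))
      ≤ ∫⁻ b, ENNReal.ofReal (Real.exp (l * (h a - h b))) ∂ν := by
    intro a
    have hia : Integrable (fun b => h a - h b) ν := (integrable_const _).sub hi
    have := jensen_exp ν (fun b => l * (h a - h b)) (by fun_prop) (hia.const_mul l)
    rwa [integral_const_mul, integral_sub (integrable_const _) hi, integral_const,
      probReal_univ, one_smul] at this
  have meas : Measurable (fun p : Y × Y => ENNReal.ofReal (Real.exp (l * (h p.1 - h p.2)))) := by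
    fun_prop
  set I := ∫⁻ a, ∫⁻ b, ENNReal.ofReal (Real.exp (l * (h a - h b))) ∂ν ∂ν with hI
  have e2 : I = ∫⁻ a, ∫⁻ b, ENNReal.ofReal (Real.exp (-(l * (h a - h b)))) ∂ν ∂ν := by
    rw [hI, lintegral_lintegral_swap meas.aemeasurable]
    refine lintegral_congr fun a => lintegral_congr fun b => ?_
    congr 2; ring
  have hpos : 0 < 1 - l * M := by linarith
  have e3 : I + I ≤ 2 * (1 + ENNReal.ofReal (l^2 * s^2 / (2 * (1 - l * M)))) := by
    calc I + I = ∫⁻ a, ∫⁻ b, (ENNReal.ofReal (Real.exp (l * (h a - h b)))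
            + ENNReal.ofReal (Real.exp (-(l * (h a - h b))))) ∂ν ∂ν := by
          conv_lhs => rw [e2]
          conv_lhs => enter [1]; rw [← e2, hI]
          rw [← lintegral_add_left (by fun_prop)]
          refine lintegral_congr fun a => ?_
          rw [lintegral_add_left (by fun_prop)]
      _ ≤ ∫⁻ a, ∫⁻ b, 2 * (1 + ∑' k : ℕ, ENNReal.ofReal (|l * (h a - h b)| ^ (k + 2)
            / (Nat.factorial (k + 2)))) ∂ν ∂ν :=
          lintegral_mono fun a => lintegral_mono fun b => exp_series_bound _
      _ = 2 * (1 + ∑' k : ℕ, ∫⁻ a, ∫⁻ b, ENNReal.ofReal (|l * (h a - h b)| ^ (k + 2)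
            / (Nat.factorial (k + 2))) ∂ν ∂ν) := by
          have : ∀ a, ∫⁻ b, 2 * (1 + ∑' k : ℕ, ENNReal.ofReal (|l * (h a - h b)| ^ (k + 2)
              / (Nat.factorial (k + 2)))) ∂ν = 2 * (1 + ∑' k : ℕ, ∫⁻ b,
                ENNReal.ofReal (|l * (h a - h b)| ^ (k + 2) / (Nat.factorial (k + 2))) ∂ν) := by
            intro a
            rw [lintegral_const_mul _ (by fun_prop), lintegral_add_left (by fun_prop),
              lintegral_tsum (fun k => by fun_prop)]
            simp
          simp_rw [this]
          rw [lintegral_const_mul _ (by fun_prop), lintegral_add_left (by fun_prop),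
              lintegral_tsum (fun k => by fun_prop)]
          simp
      _ ≤ 2 * (1 + ∑' k : ℕ, ENNReal.ofReal ((l^2 * s^2 / 2) * (l * M) ^ k)) := by
          gcongr with k
          have : ∀ a b, ENNReal.ofReal (|l * (h a - h b)| ^ (k + 2) / (Nat.factorial (k + 2)))
              = ENNReal.ofReal (l ^ (k + 2) / (Nat.factorial (k + 2)))
                * ENNReal.ofReal (|h a - h b| ^ (k + 2)) := by
            intro a b
            rw [← ENNReal.ofReal_mul (by positivity), abs_mul, abs_of_pos hl, mul_pow]
            congr 1; ring
          simp_rw [this]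
          have : ∀ a, ∫⁻ b, ENNReal.ofReal (l ^ (k + 2) / (Nat.factorial (k + 2)))
                * ENNReal.ofReal (|h a - h b| ^ (k + 2)) ∂ν = 
                ENNReal.ofReal (l ^ (k + 2) / (Nat.factorial (k + 2))) *
                 ∫⁻ b, ENNReal.ofReal (|h a - h b| ^ (k + 2)) ∂ν := fun a => 
                 lintegral_const_mul _ (by fun_prop)
          simp_rw [this]
          rw [lintegral_const_mul _ (by fun_prop)]
          refine (mul_le_mul_right (hb (k + 2) (by omega)) _).trans ?_
          rw [← ENNReal.ofReal_mul (by positivity)]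
          apply le_of_eq
          congr 1
          have : (Nat.factorial (k + 2) : ℝ) ≠ 0 := by positivity
          simp only [Nat.add_sub_cancel]
          field_simp
          ring
      _ = 2 * (1 + ENNReal.ofReal (l^2 * s^2 / (2 * (1 - l * M)))) := by
          rw [← ENNReal.ofReal_tsum_of_nonneg (fun k => by positivity)
            ((summable_geometric_of_lt_one (by positivity) hlM).mul_left _), tsum_mul_left,
            tsum_geometric_of_lt_one (by positivity) hlM]
          congr 3
          field_simp
  have e4 : I ≤ 1 + ENNReal.ofReal (l^2 * s^2 / (2 * (1 - l * M))) := by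
    rw [← two_mul] at e3
    exact (ENNReal.mul_le_mul_iff_right (by simp) (by simp)).mp e3
  refine (lintegral_mono e1).trans (e4.trans ?_)
  have h1 : (1 : ENNReal) = ENNReal.ofReal 1 := by simp
  rw [h1, ← ENNReal.ofReal_add zero_le_one (by positivity)]
  apply ENNReal.ofReal_le_ofReal
  have := Real.add_one_le_exp (l^2 * s^2 / (2 * (1 - l * M)))
  linarith

lemma mp_update {ι : Type*} [Fintype ι] [DecidableEq ι]
    (X : ι → Type*) [∀ i, MeasurableSpace (X i)]
    (μ : ∀ i, Measure (X i)) [∀ i, IsProbabilityMeasure (μ i)] (i : ι) :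
    MeasurePreserving (fun p : (∀ i, X i) × X i => Function.update p.1 i p.2)
      ((Measure.pi μ).prod (μ i)) (Measure.pi μ) := by
  refine ⟨measurable_update', ?_⟩
  symm
  apply Measure.pi_eq
  intro s hs
  rw [Measure.map_apply measurable_update' (MeasurableSet.univ_pi hs)]
  have : (fun p : (∀ i, X i) × X i => Function.update p.1 i p.2) ⁻¹' (Set.univ.pi s)
      = (Set.univ.pi (Function.update s i Set.univ)) ×ˢ s i := by
    ext p
    simp only [Set.mem_preimage, Set.mem_pi, Set.mem_univ, true_imp_iff, Set.mem_prod]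
    constructor
    · intro h
      refine ⟨fun j => ?_, by simpa using h i⟩
      by_cases hj : j = i
      · subst hj; simp
      · simpa [hj] using h j
    · rintro ⟨h, h'⟩ j
      by_cases hj : j = i
      · subst hj; simpa using h'
      · simpa [hj] using h j
  rw [this, Measure.prod_prod, Measure.pi_pi, ← Finset.prod_erase_mul _ _ (Finset.mem_univ i),
    ← Finset.prod_erase_mul _ (fun i => μ i (s i)) (Finset.mem_univ i)]
  simp only [Function.update_self, measure_univ, mul_one]
  congr 1
  refine Finset.prod_congr rfl fun j hj => ?_
  rw [Function.update_of_ne (Finset.ne_of_mem_erase hj)]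

lemma swap3 {Y Z : Type*} [MeasurableSpace Y] [MeasurableSpace Z] (ν : Measure Y) (ρ : Measure Z)
    [IsProbabilityMeasure ν] [IsProbabilityMeasure ρ] (G : Y → Y → Z → ENNReal)
    (mG : Measurable (fun p : (Y × Y) × Z => G p.1.1 p.1.2 p.2)) :
    ∫⁻ a, ∫⁻ b, ∫⁻ c, G a b c ∂ρ ∂ν ∂ν = ∫⁻ c, ∫⁻ a, ∫⁻ b, G a b c ∂ν ∂ν ∂ρ := by
  have : ∀ a, ∫⁻ b, ∫⁻ c, G a b c ∂ρ ∂ν = ∫⁻ c, ∫⁻ b, G a b c ∂ν ∂ρ := by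
    intro a
    refine lintegral_lintegral_swap (Measurable.aemeasurable ?_)
    exact mG.comp ((measurable_const.prodMk measurable_fst).prodMk measurable_snd :
      Measurable (fun p : Y × Z => ((a, p.1), p.2)))
  simp_rw [this]
  refine lintegral_lintegral_swap (Measurable.aemeasurable ?_)
  have : Measurable (fun q : (Y × Z) × Y => G q.1.1 q.2 q.1.2) :=
    mG.comp (((measurable_fst.comp measurable_fst).prodMk measurable_snd).prodMk
      (measurable_snd.comp measurable_fst) :
      Measurable (fun q : (Y × Z) × Y => ((q.1.1, q.2), q.1.2)))
  exact this.lintegral_prod_right'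

lemma meas3 {Y Z : Type*} [MeasurableSpace Y] [MeasurableSpace Z] (F : Y → Z → ℝ)
    (m1 : Measurable (fun p : Y × Z => F p.1 p.2)) (k : ℕ) :
    Measurable (fun p : (Y × Y) × Z => ENNReal.ofReal (|F p.1.1 p.2 - F p.1.2 p.2| ^ k)) := by
  have ha : Measurable (fun p : (Y × Y) × Z => F p.1.1 p.2) :=
    m1.comp ((measurable_fst.comp measurable_fst).prodMk measurable_snd)
  have hb : Measurable (fun p : (Y × Y) × Z => F p.1.2 p.2) :=
    m1.comp ((measurable_snd.comp measurable_fst).prodMk measurable_snd)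
  fun_prop

lemma bern_marginal {ι : Type*} [Fintype ι] [DecidableEq ι]
    (X : ι → Type*) [∀ i, MeasurableSpace (X i)]
    (μ : ∀ i, Measure (X i)) [∀ i, IsProbabilityMeasure (μ i)]
    (f : (∀ i, X i) → ℝ) (hfm : Measurable f)
    (hfint : Integrable f (Measure.pi μ)) (B : ℕ → ENNReal) (i j : ι) (hij : j ≠ i)
    (hbern : ∀ᵐ x ∂(Measure.pi μ), ∀ k : ℕ, 2 ≤ k →
      ∫⁻ a, ∫⁻ b,
          ENNReal.ofReal (|f (Function.update x j a) - f (Function.update x j b)| ^ k)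
        ∂(μ j) ∂(μ j) ≤ B k) :
    ∀ᵐ x ∂(Measure.pi μ), ∀ k : ℕ, 2 ≤ k →
      ∫⁻ a, ∫⁻ b,
          ENNReal.ofReal (|(∫ c, f (Function.update (Function.update x j a) i c) ∂(μ i))
            - (∫ c, f (Function.update (Function.update x j b) i c) ∂(μ i))| ^ k)
        ∂(μ j) ∂(μ j) ≤ B k := by
  have hI : ∀ᵐ x ∂(Measure.pi μ), Integrable (fun c => f (Function.update x i c)) (μ i) :=
    ((mp_update X μ i).integrable_comp_of_integrable hfint).prod_right_ae
  have hI2 := Measure.ae_ae_of_ae_prod ((mp_update X μ j).quasiMeasurePreserving.ae hI)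
  have hb2 := Measure.ae_ae_of_ae_prod ((mp_update X μ i).quasiMeasurePreserving.ae hbern)
  have mu : ∀ l : ι, Measurable fun p : (∀ i, X i) × X l => Function.update p.1 l p.2 :=
    fun l => measurable_update'
  filter_upwards [hI2, hb2] with x hx hbx k hk
  have m1 : Measurable (fun p : X j × X i => f (Function.update (Function.update x j p.1) i p.2)) :=
    hfm.comp ((mu i).comp (((measurable_update x).comp measurable_fst).prodMk measurable_snd))
  let G : X j → X j → X i → ENNReal := fun a b c =>
    ENNReal.ofReal (|f (Function.update (Function.update x j a) i c)
            - f (Function.update (Function.update x j b) i c)| ^ k)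
  have mG : Measurable (fun p : (X j × X j) × X i => G p.1.1 p.1.2 p.2) := by
    exact meas3 (fun a c => f (Function.update (Function.update x j a) i c)) m1 k
  calc _ ≤ ∫⁻ a, ∫⁻ b, ∫⁻ c, G a b c ∂(μ i) ∂(μ j) ∂(μ j) := by
        refine lintegral_mono_ae ?_
        filter_upwards [hx] with a ha
        refine lintegral_mono_ae ?_
        filter_upwards [hx] with b hb
        rw [← integral_sub ha hb]
        refine jensen_pow (μ i) _ ?_ (ha.sub hb) k
        exact (hfm.comp (measurable_update _)).sub (hfm.comp (measurable_update _))
    _ = ∫⁻ c, ∫⁻ a, ∫⁻ b, G a b c ∂(μ j) ∂(μ j) ∂(μ i) := by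
        exact swap3 (μ j) (μ i) G mG
    _ ≤ ∫⁻ c, B k ∂(μ i) := by
        refine lintegral_mono_ae ?_
        filter_upwards [hbx] with c hc
        refine le_trans (le_of_eq ?_) (hc k hk)
        refine lintegral_congr fun a => lintegral_congr fun b => ?_
        simp only [G]
        rw [Function.update_comm hij a c x, Function.update_comm hij b c x]
    _ = B k := by simp

lemma mgf_bound {ι : Type*} [Fintype ι] [DecidableEq ι]
    (X : ι → Type*) [∀ i, MeasurableSpace (X i)]
    (μ : ∀ i, Measure (X i)) [∀ i, IsProbabilityMeasure (μ i)]
    (σ : ι → ℝ) (M l : ℝ) (hM : 0 < M) (hl : 0 < l) (hlM : l * M < 1) (S : Finset ι) :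
    ∀ (f : (∀ i, X i) → ℝ) (_ : Measurable f)
    (_ : Integrable f (Measure.pi μ)) (_ : DependsOn f (S : Set ι))
    (_ : ∀ i, i ∈ S → ∀ᵐ x ∂(Measure.pi μ), ∀ k : ℕ, 2 ≤ k →
      ∫⁻ a, ∫⁻ b,
          ENNReal.ofReal (|f (Function.update x i a) - f (Function.update x i b)| ^ k)
        ∂(μ i) ∂(μ i)
        ≤ ENNReal.ofReal ((1/2) * (σ i)^2 * (Nat.factorial k) * M ^ (k - 2))),
    ∫⁻ x, ENNReal.ofReal (Real.exp (l * (f x - ∫ y, f y ∂(Measure.pi μ)))) ∂(Measure.pi μ)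
      ≤ ENNReal.ofReal (Real.exp (l^2 * (∑ i ∈ S, (σ i)^2) / (2 * (1 - l * M)))) := by
  induction S using Finset.induction_on with
  | empty =>
    intro f hfm hfint hdep _
    rw [Finset.coe_empty] at hdep
    have : ∀ x, f x - ∫ y, f y ∂(Measure.pi μ) = 0 := by
      intro x
      have h : f = fun _ => f x := funext fun y => hdep.empty y x
      rw [h]; simp
    simp [this]
  | insert i S hiS ih =>
    intro f hfm hfint hdep hbern
    set g : (∀ i, X i) → ℝ := fun x => ∫ c, f (Function.update x i c) ∂(μ i) with hg
    have mu : Measurable fun p : (∀ i, X i) × X i => Function.update p.1 i p.2 :=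
      measurable_update'
    have hint2 := (mp_update X μ i).integrable_comp_of_integrable hfint
    have hgm : Measurable g :=
      (hfm.comp mu).stronglyMeasurable.integral_prod_right'.measurable
    have hgint : Integrable g (Measure.pi μ) := hint2.integral_prod_left
    have hgE : ∫ y, g y ∂(Measure.pi μ) = ∫ y, f y ∂(Measure.pi μ) := by
      refine (integral_prod _ hint2).symm.trans ?_
      rw [← (mp_update X μ i).map_eq, integral_map mu.aemeasurable hfm.aestronglyMeasurable,
        (mp_update X μ i).map_eq]
      rfl
    have hgdep : DependsOn g (S : Set ι) := by
      intro x y hxy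
      simp only [hg]
      congr 1
      funext c
      apply hdep
      intro j hj
      by_cases hji : j = i
      · subst hji; simp
      · have : j ∈ S := by simpa [hji] using hj
        simpa [hji] using hxy j this
    have hgb := ih g hgm hgint hgdep fun j hj =>
      bern_marginal X μ f hfm hfint (fun k => ENNReal.ofReal ((1/2) * (σ j)^2 *
        (Nat.factorial k) * M ^ (k - 2))) i j (fun h => hiS (h ▸ hj))
        (hbern j (Finset.mem_insert_of_mem hj))
    rw [hgE] at hgb
    set E := ∫ y, f y ∂(Measure.pi μ) with hE
    have mF : Measurable fun x => ENNReal.ofReal (Real.exp (l * (f x - E))) := by fun_prop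
    calc ∫⁻ x, ENNReal.ofReal (Real.exp (l * (f x - E))) ∂(Measure.pi μ)
        = ∫⁻ x, ∫⁻ a, ENNReal.ofReal (Real.exp (l * (f (Function.update x i a) - E))) ∂(μ i)
            ∂(Measure.pi μ) := by
          rw [← (mp_update X μ i).lintegral_comp mF]
          exact lintegral_prod _ (mF.comp mu).aemeasurable
      _ ≤ ∫⁻ x, ENNReal.ofReal (Real.exp (l * (g x - E))) *
            ENNReal.ofReal (Real.exp (l^2 * (σ i)^2 / (2 * (1 - l * M)))) ∂(Measure.pi μ) := by
          refine lintegral_mono_ae ?_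
          filter_upwards [hbern i (Finset.mem_insert_self i S), hint2.prod_right_ae] with x hx hix
          have := one_coord (μ i) (fun a => f (Function.update x i a))
            (hfm.comp (measurable_update x)) hix (σ i) M l hM hl hlM hx
          refine le_trans (le_of_eq ?_) (mul_le_mul_right this _)
          rw [← lintegral_const_mul]
          · refine lintegral_congr fun a => ?_
            rw [← ENNReal.ofReal_mul (Real.exp_pos _).le, ← Real.exp_add]
            congr 2
            simp only [hg]
            ring
          · have := hfm.comp (measurable_update x (a := i))
            simp only [Function.comp_def] at this
            fun_prop
      _ = (∫⁻ x, ENNReal.ofReal (Real.exp (l * (g x - E))) ∂(Measure.pi μ)) *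
            ENNReal.ofReal (Real.exp (l^2 * (σ i)^2 / (2 * (1 - l * M)))) :=
          lintegral_mul_const _ (by fun_prop)
      _ ≤ _ := by
          refine (mul_le_mul_left hgb _).trans (le_of_eq ?_)
          rw [← ENNReal.ofReal_mul (Real.exp_pos _).le, ← Real.exp_add, Finset.sum_insert hiS]
          congr 2
          ring

/-- Bernstein-type McDiarmid inequality:
Let `X_1, …, X_n` be independent random elements (modeled by the product measure
`Measure.pi μ` on `∀ i, X i`), and `f` an integrable function of them.  With
`D_i = f(X) − f(X with i-th coordinate resampled)`, assume the conditional
Bernstein moment condition: for a.e. configuration of the other coordinates,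
`E(|D_i|^k ∣ X_{−i}) ≤ (1/2) σ_i² k! M^{k−2}` for all integers `k ≥ 2`
(the conditional expectation given `X_{−i}` integrates out both `X_i` and its
independent copy `X_i'`).  Then for all `t > 0`,
`P(f(X) − E f(X) ≥ t) ≤ exp(−t² / (2σ² + 2tM))` where `σ² = ∑ i σ_i²`. -/
theorem bernstein_mcdiarmid
    {ι : Type*} [Fintype ι] [DecidableEq ι]
    (X : ι → Type*) [∀ i, MeasurableSpace (X i)]
    (μ : ∀ i, Measure (X i)) [∀ i, IsProbabilityMeasure (μ i)]
    (f : (∀ i, X i) → ℝ) (hfm : Measurable f)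
    (hfint : Integrable f (Measure.pi μ))
    (σ : ι → ℝ) (M : ℝ) (hσ : ∀ i, 0 < σ i) (hM : 0 < M)
    (hbern : ∀ i, ∀ᵐ x ∂(Measure.pi μ), ∀ k : ℕ, 2 ≤ k →
      ∫⁻ a, ∫⁻ b,
          ENNReal.ofReal (|f (Function.update x i a) - f (Function.update x i b)| ^ k)
        ∂(μ i) ∂(μ i)
        ≤ ENNReal.ofReal ((1/2) * (σ i)^2 * (Nat.factorial k) * M ^ (k - 2)))
    (t : ℝ) (ht : 0 < t) :
    (Measure.pi μ) {x | t ≤ f x - ∫ y, f y ∂(Measure.pi μ)}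
      ≤ ENNReal.ofReal (Real.exp (-(t^2) / (2 * ∑ i, (σ i)^2 + 2 * t * M))) := by
  set E := ∫ y, f y ∂(Measure.pi μ) with hE
  rcases isEmpty_or_nonempty ι with hemp | hne
  · have : ∀ x, f x - E = 0 := by
      intro x
      have h : f = fun _ => f x := funext fun y => congrArg f (Subsingleton.elim _ _)
      rw [hE, h]; simp
    have h2 : {x | t ≤ f x - E} = ∅ := by
      ext x
      simp [this x, ht]
    rw [h2]; simp
  · set S := ∑ i, (σ i)^2 with hS
    have hSpos : 0 < S := Finset.sum_pos (fun i _ => pow_pos (hσ i) 2) Finset.univ_nonempty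
    have hden : 0 < S + t * M := by positivity
    set l := t / (S + t * M) with hl
    have hlpos : 0 < l := by positivity
    have hlM1 : 1 - l * M = S / (S + t * M) := by rw [hl]; field_simp; ring
    have hlM : l * M < 1 := by
      have : 0 < S / (S + t * M) := by positivity
      linarith
    have hmgf := mgf_bound X μ σ M l hM hlpos hlM Finset.univ f hfm hfint
      (by rw [Finset.coe_univ]; exact dependsOn_univ f) (fun i _ => hbern i)
    rw [← hE, ← hS] at hmgf
    have mF : Measurable fun x => ENNReal.ofReal (Real.exp (l * (f x - E))) := by fun_prop
    have hmark := mul_meas_ge_le_lintegral (μ := Measure.pi μ) mF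
      (ENNReal.ofReal (Real.exp (l * t)))
    have hsub : (Measure.pi μ) {x | t ≤ f x - E} ≤ (Measure.pi μ)
        {x | ENNReal.ofReal (Real.exp (l * t)) ≤ ENNReal.ofReal (Real.exp (l * (f x - E)))} := by
      refine measure_mono fun x hx => ?_
      simp only [Set.mem_setOf_eq] at hx ⊢
      gcongr
    have h3 := (mul_le_mul_right hsub (ENNReal.ofReal (Real.exp (l * t)))).trans
      (hmark.trans hmgf)
    have h4 := mul_le_mul_right h3 (ENNReal.ofReal (Real.exp (-(l * t))))
    rw [← mul_assoc, ← ENNReal.ofReal_mul (Real.exp_pos _).le, ← Real.exp_add,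
      ← ENNReal.ofReal_mul (Real.exp_pos _).le, ← Real.exp_add] at h4
    simp only [neg_add_cancel, Real.exp_zero, ENNReal.ofReal_one, one_mul] at h4
    refine h4.trans (le_of_eq ?_)
    congr 2
    rw [hlM1, hl]
    have : 2 * S + 2 * t * M = 2 * (S + t * M) := by ring
    rw [this]
    field_simp
    ring
end

section
/- Suppose X_1,...,X_n are i.i.d. random elements of a normed space with E‖X_1‖^k ≤ (1/2)s² k! V^{k−2} for all integers k ≥ 2, for some constants s, V > 0. Then for all t > 0, P(|W_p(μ̂, μ) − E W_p(μ̂, μ)| ≥ t) ≤ 2 exp(−t²/(8s² n^{1−2/p} + 4V t n^{−1/p})). -/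
open MeasureTheory
open scoped ENNReal

/-- The Wasserstein distance of order `p` on a normed space: the infimum over all
couplings `ξ` of `μ` and `ν` of `(∫ ‖x − y‖^p dξ)^{1/p}`. -/
noncomputable def wassersteinDist {E : Type*} [NormedAddCommGroup E] [MeasurableSpace E]
    (p : ℝ) (μ ν : Measure E) : ℝ :=
  ((⨅ ξ ∈ {ξ : Measure (E × E) | ξ.map Prod.fst = μ ∧ ξ.map Prod.snd = ν},
      ∫⁻ q, ENNReal.ofReal (‖q.1 - q.2‖ ^ p) ∂ξ) ^ (1 / p)).toReal

/-- The empirical measure of an `n`-tuple of points: mass `1/n` at each `x i`. -/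
noncomputable def empiricalMeasure {E : Type*} [MeasurableSpace E] {n : ℕ}
    (x : Fin n → E) : Measure E :=
  (n : ℝ≥0∞)⁻¹ • ∑ i, Measure.dirac (x i)

open Finset in
lemma mult_sum {E : Type*} {n : ℕ} [DecidableEq E] (x : Fin n → E) (a : E) (ha : a ∈ Set.range x) :
    ∑ i, (if a = x i then (((univ.filter fun j => x j = x i).card : ℝ≥0∞))⁻¹ else 0) = 1 := by
  obtain ⟨j, rfl⟩ := ha
  rw [← Finset.sum_filter]
  have : ∀ i ∈ univ.filter (fun i => x j = x i),
      (((univ.filter fun k => x k = x i).card : ℝ≥0∞))⁻¹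
        = (((univ.filter fun k => x j = x k).card : ℝ≥0∞))⁻¹ := by
    intro i hi
    simp only [Finset.mem_filter, Finset.mem_univ, true_and] at hi
    rw [← hi]
    simp only [eq_comm]
  rw [Finset.sum_congr rfl this, Finset.sum_const, nsmul_eq_mul]
  apply ENNReal.mul_inv_cancel
  · have : j ∈ univ.filter (fun k => x j = x k) := by simp
    simpa using ⟨j, rfl⟩
  · simp

lemma empirical_apply {E : Type*} [MeasurableSpace E] {n : ℕ} (x : Fin n → E) (A : Set E)
    (hA : MeasurableSet A) :
    empiricalMeasure x A = (n : ℝ≥0∞)⁻¹ * ∑ i, A.indicator (fun _ => (1:ℝ≥0∞)) (x i) := by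
  simp [empiricalMeasure, hA]
  rfl

/-- Disintegration of a coupling along the atoms. -/
lemma coupling_lift {E : Type*} [MeasurableSpace E] [MeasurableSingletonClass E]
    {n : ℕ} (x : Fin n → E) (μ : Measure E) (ξ : Measure (E × E))
    (h1 : ξ.map Prod.fst = empiricalMeasure x) (h2 : ξ.map Prod.snd = μ) :
    ∃ π : Fin n → Measure E, (∀ i, π i Set.univ = (n : ℝ≥0∞)⁻¹) ∧ (∑ i, π i = μ) ∧
      ∀ F : E × E → ℝ≥0∞, Measurable F →
        ∑ i, ∫⁻ y, F (x i, y) ∂(π i) = ∫⁻ q, F q ∂ξ := by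
  classical
  set m : Fin n → ℝ≥0∞ := fun i => ((Finset.univ.filter fun j => x j = x i).card : ℝ≥0∞) with hm
  have hm0 : ∀ i, m i ≠ 0 := by
    intro i
    simp only [hm]
    simpa using ⟨i, rfl⟩
  have hmt : ∀ i, m i ≠ ⊤ := by intro i; simp [hm]
  have hS : ∀ i, MeasurableSet (Prod.fst ⁻¹' {x i} : Set (E × E)) := fun i =>
    measurable_fst (measurableSet_singleton _)
  let π : Fin n → Measure E := fun i => (m i)⁻¹ • (ξ.restrict (Prod.fst ⁻¹' {x i})).map Prod.snd
  have hae : ∀ᵐ q ∂ξ, q.1 ∈ Set.range x := by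
    have hr : MeasurableSet (Set.range x)ᶜ := (Set.finite_range x).measurableSet.compl
    have : ξ.map Prod.fst (Set.range x)ᶜ = 0 := by
      rw [h1, empirical_apply _ _ hr]
      simp
    rw [Measure.map_apply measurable_fst hr] at this
    exact this
  have key : ∀ F : E × E → ℝ≥0∞, Measurable F →
        ∑ i, ∫⁻ y, F (x i, y) ∂(π i) = ∫⁻ q, F q ∂ξ := by
    intro F hF
    have e1 : ∀ i, ∫⁻ y, F (x i, y) ∂(π i)
        = ∫⁻ q, (if q.1 = x i then (m i)⁻¹ else 0) * F q ∂ξ := by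
      intro i
      simp only [π]
      rw [lintegral_smul_measure, lintegral_map (f := fun y => F (x i, y)) (hF.comp measurable_prodMk_left) measurable_snd,
        ← lintegral_indicator (hS i), smul_eq_mul, ← lintegral_const_mul' _ _ (by simpa using hm0 i)]
      refine lintegral_congr fun q => ?_
      by_cases h : q.1 = x i
      · obtain ⟨q1, q2⟩ := q
        simp only at h
        subst h
        simp [Set.indicator]
      · simp [Set.indicator, h]
    simp_rw [e1]
    rw [← lintegral_finsetSum]
    · refine lintegral_congr_ae ?_
      filter_upwards [hae] with q hq
      rw [← Finset.sum_mul, mult_sum x q.1 hq, one_mul]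
    · intro i _
      refine Measurable.mul (Measurable.ite (hS i) ?_ ?_) hF <;> fun_prop
  refine ⟨π, ?_, ?_, key⟩
  · intro i
    simp only [π, Measure.smul_apply, smul_eq_mul]
    rw [Measure.map_apply measurable_snd MeasurableSet.univ, Set.preimage_univ,
      Measure.restrict_apply_univ, ← Measure.map_apply measurable_fst (measurableSet_singleton _),
      h1, empirical_apply _ _ (measurableSet_singleton _)]
    have : ∑ j, ({x i} : Set E).indicator (fun _ => (1:ℝ≥0∞)) (x j) = m i := by
      simp [hm, Set.indicator]
    rw [this, mul_comm, mul_assoc, ENNReal.mul_inv_cancel (hm0 i) (hmt i), mul_one]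
  · ext A hA
    have := key (fun q => A.indicator (fun _ => 1) q.2)
      ((measurable_const.indicator hA).comp measurable_snd)
    rw [← h2, Measure.map_apply measurable_snd hA, ← lintegral_indicator_one (measurable_snd hA)]
    rw [Measure.coe_finsetSum, Finset.sum_apply]
    simp only [lintegral_indicator_const hA, one_mul] at this
    rw [this]
    rfl

lemma coupling_build {E : Type*} [MeasurableSpace E]
    {n : ℕ} (x : Fin n → E) (μ : Measure E) (π : Fin n → Measure E)
    (h1 : ∀ i, π i Set.univ = (n : ℝ≥0∞)⁻¹) (h2 : ∑ i, π i = μ) :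
    ∃ ξ : Measure (E × E), ξ.map Prod.fst = empiricalMeasure x ∧ ξ.map Prod.snd = μ ∧
      ∀ F : E × E → ℝ≥0∞, Measurable F →
        ∫⁻ q, F q ∂ξ = ∑ i, ∫⁻ y, F (x i, y) ∂(π i) := by
  let ξ : Measure (E × E) := ∑ i, (π i).map (fun y => (x i, y))
  have key : ∀ F : E × E → ℝ≥0∞, Measurable F →
        ∫⁻ q, F q ∂ξ = ∑ i, ∫⁻ y, F (x i, y) ∂(π i) := by
    intro F hF
    simp only [ξ]
    rw [lintegral_finsetSum_measure]
    refine Finset.sum_congr rfl fun i _ => ?_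
    rw [lintegral_map hF measurable_prodMk_left]
  refine ⟨ξ, ?_, ?_, key⟩
  · ext A hA
    rw [Measure.map_apply measurable_fst hA, ← lintegral_indicator_one (measurable_fst hA),
      key _ (measurable_one.indicator (measurable_fst hA)), empirical_apply _ _ hA, Finset.mul_sum]
    refine Finset.sum_congr rfl fun i _ => ?_
    have : ∀ y, (Prod.fst ⁻¹' A).indicator (1 : E × E → ℝ≥0∞) (x i, y)
        = A.indicator (fun _ => (1:ℝ≥0∞)) (x i) := fun y => rfl
    simp only [this, lintegral_const, h1, mul_comm]
  · ext A hA
    rw [Measure.map_apply measurable_snd hA, ← lintegral_indicator_one (measurable_snd hA),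
      key _ (measurable_one.indicator (measurable_snd hA)), ← h2, Measure.coe_finsetSum,
      Finset.sum_apply]
    refine Finset.sum_congr rfl fun i _ => ?_
    rw [← lintegral_indicator_one hA]
    rfl

/-- The transport cost infimum. -/
noncomputable def wcost {E : Type*} [NormedAddCommGroup E] [MeasurableSpace E]
    (p : ℝ) (μ ν : Measure E) : ℝ≥0∞ :=
  ⨅ ξ ∈ {ξ : Measure (E × E) | ξ.map Prod.fst = μ ∧ ξ.map Prod.snd = ν},
      ∫⁻ q, ENNReal.ofReal (‖q.1 - q.2‖ ^ p) ∂ξ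

section W
variable {E : Type*} [NormedAddCommGroup E] [MeasurableSpace E] [BorelSpace E]
    [SecondCountableTopology E]

lemma meas_cost (p : ℝ) : Measurable (fun q : E × E => ENNReal.ofReal (‖q.1 - q.2‖ ^ p)) := by
  fun_prop

/-- Minkowski over a family of measures. -/
lemma family_minkowski (p : ℝ) (hp : 1 ≤ p) {n : ℕ} (π : Fin n → Measure E)
    (h1 : ∀ i, π i Set.univ = (n : ℝ≥0∞)⁻¹) (x x' : Fin n → E) :
    (∑ i, ∫⁻ y, ENNReal.ofReal (‖x i - y‖ ^ p) ∂(π i)) ^ (1 / p)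
      ≤ (∑ i, ∫⁻ y, ENNReal.ofReal (‖x' i - y‖ ^ p) ∂(π i)) ^ (1 / p)
        + (∑ i, ENNReal.ofReal (‖x i - x' i‖ ^ p) * (n : ℝ≥0∞)⁻¹) ^ (1 / p) := by
  have hp0 : 0 < p := by linarith
  let P : Measure (Fin n × E) := ∑ i, (π i).map (fun y => (i, y))
  have key : ∀ F : Fin n × E → ℝ≥0∞, Measurable F →
        ∫⁻ q, F q ∂P = ∑ i, ∫⁻ y, F (i, y) ∂(π i) := by
    intro F hF
    simp only [P]
    rw [lintegral_finsetSum_measure]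
    refine Finset.sum_congr rfl fun i _ => ?_
    rw [lintegral_map hF measurable_prodMk_left]
  have hx : ∀ z : Fin n → E, Measurable fun q : Fin n × E => z q.1 := fun z =>
    (measurable_of_finite z).comp measurable_fst
  let f : (Fin n → E) → Fin n × E → ℝ≥0∞ := fun z q => ENNReal.ofReal ‖z q.1 - q.2‖
  have hf : ∀ z, Measurable (f z) := by
    intro z
    have := hx z
    simp only [f]
    fun_prop
  let g : Fin n × E → ℝ≥0∞ := fun q => ENNReal.ofReal ‖x q.1 - x' q.1‖
  have hg : Measurable g := by
    have := hx x
    have := hx x'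
    simp only [g]
    fun_prop
  have e1 : ∀ z : Fin n → E, ∑ i, ∫⁻ y, ENNReal.ofReal (‖z i - y‖ ^ p) ∂(π i)
      = ∫⁻ q, (f z q) ^ p ∂P := by
    intro z
    rw [key _ ((hf z).pow_const p)]
    simp only [f, ENNReal.ofReal_rpow_of_nonneg (norm_nonneg _) hp0.le]
  have e2 : ∑ i, ENNReal.ofReal (‖x i - x' i‖ ^ p) * (n : ℝ≥0∞)⁻¹ = ∫⁻ q, (g q) ^ p ∂P := by
    rw [key _ (hg.pow_const p)]
    simp only [g, ENNReal.ofReal_rpow_of_nonneg (norm_nonneg _) hp0.le, lintegral_const, h1]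
  rw [e1, e1, e2]
  refine le_trans ?_ (ENNReal.lintegral_Lp_add_le (hf x').aemeasurable hg.aemeasurable hp)
  gcongr with q
  simp only [f, g, Pi.add_apply]
  rw [← ENNReal.ofReal_add (norm_nonneg _) (norm_nonneg _)]
  apply ENNReal.ofReal_le_ofReal
  have : x q.1 - q.2 = (x' q.1 - q.2) + (x q.1 - x' q.1) := by abel
  rw [this]
  exact norm_add_le _ _

lemma avg_le (p : ℝ) (hp : 1 ≤ p) {n : ℕ} (hn : 0 < n) (d : Fin n → ℝ) (hd : ∀ i, 0 ≤ d i) :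
    (∑ i, ENNReal.ofReal (d i ^ p) * (n : ℝ≥0∞)⁻¹) ^ (1 / p)
      ≤ ENNReal.ofReal ((n:ℝ) ^ (-(1/p)) * ∑ i, d i) := by
  have hp0 : 0 < p := by linarith
  have hn' : (0:ℝ) < n := by exact_mod_cast hn
  rw [← Finset.sum_mul, ENNReal.mul_rpow_of_nonneg _ _ (by positivity),
    ENNReal.ofReal_mul (by positivity), mul_comm, ENNReal.inv_rpow, ← ENNReal.rpow_neg,
    ← ENNReal.ofReal_natCast, ENNReal.ofReal_rpow_of_pos hn']
  gcongr
  rw [ENNReal.ofReal_sum_of_nonneg fun i _ => hd i]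
  simp only [← ENNReal.ofReal_rpow_of_nonneg (hd _) hp0.le]
  have : ∀ S : Finset (Fin n), (∑ i ∈ S, ENNReal.ofReal (d i) ^ p) ^ (1 / p)
      ≤ ∑ i ∈ S, ENNReal.ofReal (d i) := by
    intro S
    induction S using Finset.induction_on with
    | empty => simp [hp0]
    | insert a S ha ih =>
      rw [Finset.sum_insert ha, Finset.sum_insert ha]
      refine (ENNReal.rpow_add_le_add_rpow _ _ (by positivity)
        ((div_le_one hp0).2 hp)).trans ?_
      rw [← ENNReal.rpow_mul, mul_one_div_cancel hp0.ne', ENNReal.rpow_one]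
      gcongr
  exact this _

lemma wcost_le (p : ℝ) (hp : 1 ≤ p) {n : ℕ} (hn : 0 < n) (μ : Measure E) (x x' : Fin n → E) :
    (wcost p (empiricalMeasure x) μ) ^ (1 / p) ≤
      (wcost p (empiricalMeasure x') μ) ^ (1 / p)
        + ENNReal.ofReal ((n:ℝ) ^ (-(1/p)) * ∑ i, ‖x i - x' i‖) := by
  have hp0 : 0 < p := by linarith
  have hmono : ∀ z : ℝ≥0∞, z ^ (1/p) = ENNReal.orderIsoRpow (1/p) (by positivity) z := fun z => rfl
  have : ∀ ξ ∈ {ξ : Measure (E × E) | ξ.map Prod.fst = empiricalMeasure x' ∧ ξ.map Prod.snd = μ},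
      (wcost p (empiricalMeasure x) μ) ^ (1 / p) ≤
        (∫⁻ q, ENNReal.ofReal (‖q.1 - q.2‖ ^ p) ∂ξ) ^ (1 / p)
        + ENNReal.ofReal ((n:ℝ) ^ (-(1/p)) * ∑ i, ‖x i - x' i‖) := by
    rintro ξ ⟨hξ1, hξ2⟩
    obtain ⟨π, h1, h2, h3⟩ := coupling_lift x' μ ξ hξ1 hξ2
    obtain ⟨ξ', k1, k2, k3⟩ := coupling_build x μ π h1 h2
    have hle : wcost p (empiricalMeasure x) μ ≤ ∫⁻ q, ENNReal.ofReal (‖q.1 - q.2‖ ^ p) ∂ξ' :=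
      iInf₂_le ξ' ⟨k1, k2⟩
    rw [k3 _ (meas_cost p)] at hle
    rw [← h3 _ (meas_cost p)]
    calc _ ≤ _ := ENNReal.rpow_le_rpow hle (by positivity)
      _ ≤ _ := family_minkowski p hp π h1 x x'
      _ ≤ _ := by gcongr; exact avg_le p hp hn _ fun i => norm_nonneg _
  conv_rhs => rw [wcost, hmono]
  simp only [OrderIso.map_iInf, ENNReal.iInf_add]
  exact le_iInf₂ this

lemma wcost_ne_top (p : ℝ) (hp : 1 ≤ p) {n : ℕ} (hn : 0 < n) (μ : Measure E)
    [IsProbabilityMeasure μ]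
    (hk : ∀ k : ℕ, 2 ≤ k → ∫⁻ x, ENNReal.ofReal (‖x‖ ^ k) ∂μ < ⊤) (x : Fin n → E) :
    wcost p (empiricalMeasure x) μ ≠ ⊤ := by
  have hp0 : 0 < p := by linarith
  obtain ⟨ξ, k1, k2, k3⟩ := coupling_build x μ (fun _ => (n : ℝ≥0∞)⁻¹ • μ) (by simp) (by
    ext A hA
    simp only [Finset.sum_const, Finset.card_univ, Fintype.card_fin, Measure.smul_apply, nsmul_eq_mul, smul_eq_mul]
    simp [← mul_assoc, ENNReal.mul_inv_cancel, hn.ne'])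
  refine ne_top_of_le_ne_top ?_ (iInf₂_le ξ ⟨k1, k2⟩)
  rw [k3 _ (meas_cost p)]
  refine (ENNReal.sum_lt_top.2 fun i _ => ?_).ne
  rw [lintegral_smul_measure]
  refine ENNReal.mul_lt_top (by simp [hn]) ?_
  set k := max 2 ⌈p⌉₊
  have hpk : p ≤ (k:ℝ) := (Nat.le_ceil p).trans (by exact_mod_cast le_max_right _ _)
  have hb : ∀ y, ENNReal.ofReal (‖x i - y‖ ^ p) ≤
      ENNReal.ofReal (1 + 2^(k-1) * ‖x i‖^k) + ENNReal.ofReal (2^(k-1)) * ENNReal.ofReal (‖y‖^k) := by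
    intro y
    rw [← ENNReal.ofReal_mul (by positivity), ← ENNReal.ofReal_add (by positivity) (by positivity)]
    apply ENNReal.ofReal_le_ofReal
    have a1 : ‖x i - y‖ ^ p ≤ 1 + ‖x i - y‖ ^ k := by
      rcases le_total ‖x i - y‖ 1 with h | h
      · have := Real.rpow_le_one (norm_nonneg (x i - y)) h hp0.le
        have : 0 ≤ ‖x i - y‖ ^ k := by positivity
        linarith
      · have := Real.rpow_le_rpow_of_exponent_le h hpk
        rw [Real.rpow_natCast] at this
        linarith
    have a2 : ‖x i - y‖ ^ k ≤ (‖x i‖ + ‖y‖)^k := by gcongr; exact norm_sub_le _ _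
    have a3 := add_pow_le (norm_nonneg (x i)) (norm_nonneg y) k
    linarith
  refine (lintegral_mono hb).trans_lt ?_
  rw [lintegral_add_left measurable_const, lintegral_const_mul' _ _ (by simp)]
  simp only [lintegral_const, measure_univ, mul_one]
  exact ENNReal.add_lt_top.2 ⟨by simp, ENNReal.mul_lt_top (by simp) (hk k (le_max_left _ _))⟩

lemma wass_lip (p : ℝ) (hp : 1 ≤ p) {n : ℕ} (hn : 0 < n) (μ : Measure E)
    [IsProbabilityMeasure μ]
    (hk : ∀ k : ℕ, 2 ≤ k → ∫⁻ x, ENNReal.ofReal (‖x‖ ^ k) ∂μ < ⊤) (x x' : Fin n → E) :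
    wassersteinDist p (empiricalMeasure x) μ - wassersteinDist p (empiricalMeasure x') μ
      ≤ (n:ℝ) ^ (-(1/p)) * ∑ i, ‖x i - x' i‖ := by
  have hp0 : 0 < p := by linarith
  have h := wcost_le p hp hn μ x x'
  have ht : ∀ z : Fin n → E, (wcost p (empiricalMeasure z) μ) ^ (1 / p) ≠ ⊤ := fun z =>
    ENNReal.rpow_ne_top_of_nonneg (by positivity) (wcost_ne_top p hp hn μ hk z)
  have h' := ENNReal.toReal_mono (ENNReal.add_ne_top.2 ⟨ht x', by simp⟩) h
  rw [ENNReal.toReal_add (ht x') (by simp), ENNReal.toReal_ofReal (by positivity)] at h'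
  change ((wcost p (empiricalMeasure x) μ) ^ (1 / p)).toReal -
    ((wcost p (empiricalMeasure x') μ) ^ (1 / p)).toReal ≤ _
  linarith
end W

section C
variable {E : Type*} [NormedAddCommGroup E] [MeasurableSpace E] [BorelSpace E]
    [SecondCountableTopology E]

lemma integrable_norm_pow (μ : Measure E) (k : ℕ)
    (hk : ∫⁻ x, ENNReal.ofReal (‖x‖ ^ k) ∂μ < ⊤) : Integrable (fun x => ‖x‖ ^ k) μ := by
  refine ⟨by fun_prop, ?_⟩
  rw [hasFiniteIntegral_iff_ofReal (Filter.Eventually.of_forall fun x => by positivity)]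
  exact hk

lemma integrable_norm_of_sq (μ : Measure E) [IsProbabilityMeasure μ]
    (hk : ∫⁻ x, ENNReal.ofReal (‖x‖ ^ 2) ∂μ < ⊤) : Integrable (fun x => ‖x‖) μ := by
  refine Integrable.mono' ((integrable_const (1:ℝ)).add (integrable_norm_pow μ 2 hk)) (by fun_prop) ?_
  refine Filter.Eventually.of_forall fun x => ?_
  simp only [norm_norm, Pi.add_apply]
  nlinarith [sq_nonneg (‖x‖ - 1)]

lemma cont_of_l1 {n : ℕ} (f : (Fin n → E) → ℝ) (c : ℝ) (hc : 0 ≤ c)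
    (hf : ∀ x y, f x - f y ≤ c * ∑ i, ‖x i - y i‖) : Continuous f := by
  have : LipschitzWith (Real.toNNReal (c * n)) f := by
    refine LipschitzWith.of_le_add_mul' _ fun x y => ?_
    have h1 := hf x y
    have h2 : ∑ i, ‖x i - y i‖ ≤ ∑ i : Fin n, dist x y := by
      refine Finset.sum_le_sum fun i _ => ?_
      rw [← dist_eq_norm]
      exact dist_le_pi_dist x y i
    simp only [Finset.sum_const, Finset.card_univ, Fintype.card_fin, nsmul_eq_mul] at h2
    have := mul_le_mul_of_nonneg_left h2 hc
    linarith
  exact this.continuous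

lemma integrable_of_l1 {n : ℕ} (μ : Measure E) [IsProbabilityMeasure μ]
    (hi : Integrable (fun x => ‖x‖) μ) (f : (Fin n → E) → ℝ) (c : ℝ) (hc : 0 ≤ c)
    (hf : ∀ x y, f x - f y ≤ c * ∑ i, ‖x i - y i‖) :
    Integrable f (Measure.pi fun _ : Fin n => μ) := by
  have hs : Integrable (fun x : Fin n → E => ∑ i, ‖x i‖) (Measure.pi fun _ : Fin n => μ) := by
    refine integrable_finsetSum _ fun i _ => ?_
    exact (measurePreserving_eval (fun _ : Fin n => μ) i).integrable_comp_of_integrable hi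
  refine Integrable.mono' ((integrable_const |f 0|).add (hs.const_mul c))
    (cont_of_l1 f c hc hf).aestronglyMeasurable ?_
  refine Filter.Eventually.of_forall fun x => ?_
  have h1 := hf x 0
  have h2 := hf 0 x
  simp only [Pi.zero_apply, sub_zero, zero_sub, norm_neg] at h1 h2
  simp only [Real.norm_eq_abs, Pi.add_apply]
  rw [abs_le]
  constructor <;> linarith [le_abs_self (f 0), neg_abs_le (f 0)]

lemma exp_tail_hasSum (x : ℝ) :
    HasSum (fun k : ℕ => x ^ (k+2) / (Nat.factorial (k+2) : ℝ)) (Real.exp x - 1 - x) := by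
  have h := NormedSpace.expSeries_div_hasSum_exp (𝔸 := ℝ) x
  rw [← Real.exp_eq_exp_ℝ] at h
  have := (hasSum_nat_add_iff' 2).2 h
  have e : ∑ i ∈ Finset.range 2, x ^ i / (Nat.factorial i : ℝ) = 1 + x := by
    simp [Finset.sum_range_succ]
  rw [e] at this
  rwa [sub_sub]

lemma one_dim (μ : Measure E) [IsProbabilityMeasure μ]
    (s V : ℝ) (hs : 0 < s) (hV : 0 < V)
    (hmom : ∀ k : ℕ, 2 ≤ k →
      ∫⁻ x, ENNReal.ofReal (‖x‖ ^ k) ∂μ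
        ≤ ENNReal.ofReal ((1/2) * s^2 * (Nat.factorial k) * V ^ (k - 2)))
    (c : ℝ) (hc : 0 ≤ c) (g : E → ℝ) (hg : ∀ a b, g a - g b ≤ c * ‖a - b‖)
    (l : ℝ) (hl : 0 ≤ l) (hlM : l * (2 * V * c) < 1) :
    ∫⁻ a, ENNReal.ofReal (Real.exp (l * (g a - ∫ b, g b ∂μ))) ∂μ
      ≤ ENNReal.ofReal (Real.exp (l^2 * (2*s*c)^2 / (2 * (1 - l * (2*V*c))))) := by
  have hfin : ∀ k : ℕ, 2 ≤ k → ∫⁻ x, ENNReal.ofReal (‖x‖ ^ k) ∂μ < ⊤ := fun k hk =>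
    (hmom k hk).trans_lt ENNReal.ofReal_lt_top
  have hi := integrable_norm_of_sq μ (hfin 2 le_rfl)
  have hgc : Continuous g := by
    refine (LipschitzWith.of_le_add_mul' c fun x y => ?_ :
      LipschitzWith (Real.toNNReal c) g).continuous
    have := hg x y
    rw [dist_eq_norm]
    linarith
  have hgi : Integrable g μ := by
    refine Integrable.mono' ((integrable_const |g 0|).add (hi.const_mul c))
      hgc.aestronglyMeasurable ?_
    refine Filter.Eventually.of_forall fun x => ?_
    have h1 := hg x 0
    have h2 := hg 0 x
    simp only [sub_zero, zero_sub, norm_neg] at h1 h2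
    simp only [Real.norm_eq_abs, Pi.add_apply]
    rw [abs_le]
    constructor <;> linarith [le_abs_self (g 0), neg_abs_le (g 0)]
  set G := ∫ b, g b ∂μ with hG
  set m := ∫ b, ‖b‖ ∂μ with hm
  have hm0 : 0 ≤ m := integral_nonneg fun _ => norm_nonneg _
  -- pointwise deviation
  have hd : ∀ a, |g a - G| ≤ c * (‖a‖ + m) := by
    intro a
    have hint : Integrable (fun b => c * (‖a‖ + ‖b‖)) μ :=
      ((integrable_const _).add hi).const_mul c
    have e1 : ∫ b, c * (‖a‖ + ‖b‖) ∂μ = c * (‖a‖ + m) := by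
      rw [integral_const_mul, integral_add (integrable_const _) hi]
      simp [hm]
    have e2 : ∫ b, (g a - g b) ∂μ = g a - G := by
      rw [integral_sub (integrable_const _) hgi]
      simp [hG]
    rw [← e1, ← e2, ← Real.norm_eq_abs]
    refine norm_integral_le_of_norm_le hint (Filter.Eventually.of_forall fun b => ?_)
    rw [Real.norm_eq_abs, abs_le]
    have h1 := hg a b
    have h2 := hg b a
    rw [norm_sub_rev] at h2
    have h3 := mul_le_mul_of_nonneg_left (norm_sub_le a b) hc
    constructor <;> linarith
  -- moments
  have hmk : ∀ k : ℕ, 2 ≤ k → ∫⁻ a, ENNReal.ofReal ((‖a‖ + m)^k) ∂μ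
      ≤ ENNReal.ofReal (2^k * ((1/2) * s^2 * (Nat.factorial k) * V ^ (k - 2))) := by
    intro k hk
    have hik := integrable_norm_pow μ k (hfin k hk)
    have hB : ∫ x, ‖x‖^k ∂μ ≤ (1/2) * s^2 * (Nat.factorial k) * V ^ (k - 2) := by
      rw [← ENNReal.ofReal_le_ofReal_iff (by positivity),
        ofReal_integral_eq_lintegral_ofReal hik (Filter.Eventually.of_forall fun x => by positivity)]
      exact hmom k hk
    have hJ : m ^ k ≤ ∫ x, ‖x‖^k ∂μ :=
      (convexOn_pow k).map_integral_le (by fun_prop) isClosed_Ici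
        (Filter.Eventually.of_forall fun x => norm_nonneg x) hi hik
    have hint : Integrable (fun a : E => 2^(k-1) * (‖a‖^k + m^k)) μ :=
      (hik.add (integrable_const _)).const_mul _
    calc ∫⁻ a, ENNReal.ofReal ((‖a‖ + m)^k) ∂μ
        ≤ ∫⁻ a, ENNReal.ofReal (2^(k-1) * (‖a‖^k + m^k)) ∂μ := by
          refine lintegral_mono fun a => ENNReal.ofReal_le_ofReal ?_
          exact add_pow_le (norm_nonneg _) hm0 k
      _ = ENNReal.ofReal (∫ a, 2^(k-1) * (‖a‖^k + m^k) ∂μ) := by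
          rw [ofReal_integral_eq_lintegral_ofReal hint
            (Filter.Eventually.of_forall fun x => by positivity)]
      _ ≤ _ := by
          apply ENNReal.ofReal_le_ofReal
          rw [integral_const_mul, integral_add hik (integrable_const _)]
          simp only [integral_const, probReal_univ, one_smul]
          have : (2:ℝ)^k = 2^(k-1) * 2 := by
            rw [← pow_succ]; congr 1; omega
          rw [this, mul_assoc]
          gcongr
          linarith
  set M := 2 * V * c with hM
  have hM0 : 0 ≤ M := by positivity
  set r : E → ℝ := fun a => Real.exp (l * (g a - G)) - 1 - l * (g a - G) with hr
  have hrc : Continuous r := by fun_prop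
  have hr0 : ∀ a, 0 ≤ r a := fun a => by
    have := Real.add_one_le_exp (l * (g a - G))
    simp only [hr]; linarith
  set B := l^2 * (2*s*c)^2 / (2 * (1 - l * M)) with hB
  have hden : 0 < 1 - l * M := by linarith
  have hB0 : 0 ≤ B := by positivity
  have hrB : ∫⁻ a, ENNReal.ofReal (r a) ∂μ ≤ ENNReal.ofReal B := by
    have hgeo : HasSum (fun k : ℕ => (l^2 * (2*s*c)^2 / 2) * (l*M)^k) B := by
      have := (hasSum_geometric_of_lt_one (by positivity) hlM).mul_left (l^2 * (2*s*c)^2 / 2)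
      have e : l^2 * (2*s*c)^2 / 2 * (1 - l * M)⁻¹ = B := by
        rw [hB]; field_simp
      rwa [e] at this
    calc ∫⁻ a, ENNReal.ofReal (r a) ∂μ
        ≤ ∫⁻ a, ∑' k : ℕ, ENNReal.ofReal ((l * c)^(k+2) / (Nat.factorial (k+2)))
            * ENNReal.ofReal ((‖a‖ + m)^(k+2)) ∂μ := by
          refine lintegral_mono fun a => ?_
          have h1 := exp_tail_hasSum (l * (g a - G))
          have h2 := exp_tail_hasSum (l * c * (‖a‖ + m))
          have hle : r a ≤ Real.exp (l * c * (‖a‖ + m)) - 1 - l * c * (‖a‖ + m) := by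
            refine hasSum_le (fun k => ?_) h1 h2
            refine div_le_div_of_nonneg_right ?_ (by positivity)
            refine (le_abs_self _).trans ?_
            rw [abs_pow, abs_mul, abs_of_nonneg hl, mul_assoc]
            gcongr
            exact hd a
          refine (ENNReal.ofReal_le_ofReal hle).trans ?_
          rw [← h2.tsum_eq, ENNReal.ofReal_tsum_of_nonneg (fun k => by positivity) h2.summable]
          refine ENNReal.tsum_le_tsum fun k => ?_
          rw [← ENNReal.ofReal_mul (by positivity)]
          apply ENNReal.ofReal_le_ofReal
          rw [mul_pow]
          apply le_of_eq
          ring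
      _ = ∑' k : ℕ, ENNReal.ofReal ((l * c)^(k+2) / (Nat.factorial (k+2)))
            * ∫⁻ a, ENNReal.ofReal ((‖a‖ + m)^(k+2)) ∂μ := by
          rw [lintegral_tsum (fun k => by fun_prop)]
          congr 1; ext k
          rw [lintegral_const_mul' _ _ (by simp)]
      _ ≤ ∑' k : ℕ, ENNReal.ofReal ((l^2 * (2*s*c)^2 / 2) * (l*M)^k) := by
          refine ENNReal.tsum_le_tsum fun k => ?_
          refine (mul_le_mul_right (hmk (k+2) (by omega)) _).trans ?_
          rw [← ENNReal.ofReal_mul (by positivity)]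
          apply ENNReal.ofReal_le_ofReal
          apply le_of_eq
          have : ((Nat.factorial (k+2) : ℕ) : ℝ) ≠ 0 := by positivity
          rw [hM]
          simp only [Nat.add_sub_cancel]
          field_simp
          ring
      _ = ENNReal.ofReal B := by
          rw [← ENNReal.ofReal_tsum_of_nonneg (fun k => by positivity) hgeo.summable, hgeo.tsum_eq]
  have hri : Integrable r μ := by
    refine ⟨hrc.aestronglyMeasurable, ?_⟩
    rw [hasFiniteIntegral_iff_ofReal (Filter.Eventually.of_forall hr0)]
    exact hrB.trans_lt ENNReal.ofReal_lt_top
  have hrI : ∫ a, r a ∂μ ≤ B := by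
    rw [← ENNReal.ofReal_le_ofReal_iff hB0,
      ofReal_integral_eq_lintegral_ofReal hri (Filter.Eventually.of_forall hr0)]
    exact hrB
  have hdi : Integrable (fun a => l * (g a - G)) μ := (hgi.sub (integrable_const _)).const_mul l
  have hexp : (fun a => Real.exp (l * (g a - G))) = fun a => (1 + l * (g a - G)) + r a := by
    ext a; simp only [hr]; ring
  have hei : Integrable (fun a => Real.exp (l * (g a - G))) μ := by
    rw [hexp]
    exact ((integrable_const _).add hdi).add hri
  rw [← ofReal_integral_eq_lintegral_ofReal hei
    (Filter.Eventually.of_forall fun x => (Real.exp_pos _).le)]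
  apply ENNReal.ofReal_le_ofReal
  have hdi1 : Integrable (fun a => 1 + l * (g a - G)) μ := (integrable_const _).add hdi
  have e0 : ∫ a, l * (g a - G) ∂μ = 0 := by
    rw [integral_const_mul, integral_sub hgi (integrable_const _)]
    simp [hG]
  rw [hexp, integral_add hdi1 hri,
    integral_add (integrable_const _) hdi, e0]
  simp only [integral_const, probReal_univ, one_smul]
  linarith [Real.add_one_le_exp B]

lemma mp_cons (μ : Measure E) [IsProbabilityMeasure μ] (n : ℕ) :
    MeasurePreserving (fun q : E × (Fin n → E) => (Fin.cons q.1 q.2 : Fin (n+1) → E))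
      (μ.prod (Measure.pi fun _ : Fin n => μ)) (Measure.pi fun _ : Fin (n+1) => μ) := by
  have h := (measurePreserving_piFinSuccAbove (fun _ : Fin (n+1) => μ) 0).symm
  convert h using 1
  ext q
  simp [MeasurableEquiv.piFinSuccAbove, Fin.insertNthEquiv]

lemma mgf_bound_s7 (μ : Measure E) [IsProbabilityMeasure μ]
    (s V : ℝ) (hs : 0 < s) (hV : 0 < V)
    (hmom : ∀ k : ℕ, 2 ≤ k →
      ∫⁻ x, ENNReal.ofReal (‖x‖ ^ k) ∂μ
        ≤ ENNReal.ofReal ((1/2) * s^2 * (Nat.factorial k) * V ^ (k - 2)))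
    (c : ℝ) (hc : 0 ≤ c) (l : ℝ) (hl : 0 ≤ l) (hlM : l * (2 * V * c) < 1) (n : ℕ) :
    ∀ (f : (Fin n → E) → ℝ) (_ : ∀ x y, f x - f y ≤ c * ∑ i, ‖x i - y i‖),
    ∫⁻ x, ENNReal.ofReal (Real.exp (l * (f x - ∫ y, f y ∂(Measure.pi fun _ : Fin n => μ))))
        ∂(Measure.pi fun _ : Fin n => μ)
      ≤ ENNReal.ofReal (Real.exp (l^2 * (2*s*c)^2 / (2 * (1 - l * (2*V*c))))) ^ n := by
  have hi := integrable_norm_of_sq μ ((hmom 2 le_rfl).trans_lt ENNReal.ofReal_lt_top)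
  induction n with
  | zero =>
    intro f _
    have : ∀ x : Fin 0 → E, f x = f 0 := fun x => congrArg f (Subsingleton.elim _ _)
    simp [this]
  | succ n ih =>
    intro f hf
    set P := Measure.pi fun _ : Fin n => μ with hP
    have hmp := mp_cons μ n
    have hfc := cont_of_l1 f c hc hf
    have hfi := integrable_of_l1 μ hi f c hc hf
    have hfi' : Integrable (fun q : E × (Fin n → E) => f (Fin.cons q.1 q.2)) (μ.prod P) :=
      hmp.integrable_comp_of_integrable hfi
    have hsec : ∀ a, ∀ x y : Fin n → E,
        f (Fin.cons a x) - f (Fin.cons a y) ≤ c * ∑ i, ‖x i - y i‖ := by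
      intro a x y
      have := hf (Fin.cons a x) (Fin.cons a y)
      simpa [Fin.sum_univ_succ] using this
    set g : E → ℝ := fun a => ∫ y, f (Fin.cons a y) ∂P with hgdef
    have hsi : ∀ a, Integrable (fun y => f (Fin.cons a y)) P := fun a =>
      integrable_of_l1 μ hi _ c hc (hsec a)
    have hg : ∀ a b, g a - g b ≤ c * ‖a - b‖ := by
      intro a b
      simp only [hgdef]
      rw [← integral_sub (hsi a) (hsi b)]
      calc _ ≤ ∫ y, c * ‖a - b‖ ∂P := by
            refine integral_mono ((hsi a).sub (hsi b)) (integrable_const _) fun y => ?_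
            have := hf (Fin.cons a y) (Fin.cons b y)
            simpa [Fin.sum_univ_succ] using this
        _ = _ := by simp
    have hF : ∫ x, f x ∂(Measure.pi fun _ : Fin (n+1) => μ) = ∫ a, g a ∂μ := by
      rw [← hmp.map_eq, integral_map hmp.measurable.aemeasurable hfc.aestronglyMeasurable,
        integral_prod _ hfi']
    rw [hF]
    set G := ∫ a, g a ∂μ
    set K := ENNReal.ofReal (Real.exp (l^2 * (2*s*c)^2 / (2 * (1 - l * (2*V*c)))))
    have hme : Measurable fun x => ENNReal.ofReal (Real.exp (l * (f x - G))) := by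
      have := hfc.measurable
      fun_prop
    rw [← hmp.map_eq, lintegral_map hme hmp.measurable,
      lintegral_prod (fun a : E × (Fin n → E) => ENNReal.ofReal (Real.exp (l * (f (Fin.cons a.1 a.2) - G))))
        (hme.comp hmp.measurable).aemeasurable]
    calc ∫⁻ a, ∫⁻ y, ENNReal.ofReal (Real.exp (l * (f (Fin.cons a y) - G))) ∂P ∂μ
        = ∫⁻ a, ENNReal.ofReal (Real.exp (l * (g a - G))) *
            ∫⁻ y, ENNReal.ofReal (Real.exp (l * (f (Fin.cons a y) - g a))) ∂P ∂μ := by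
          refine lintegral_congr fun a => ?_
          rw [← lintegral_const_mul' _ _ (by simp)]
          refine lintegral_congr fun y => ?_
          rw [← ENNReal.ofReal_mul (Real.exp_pos _).le, ← Real.exp_add]
          congr 2
          ring
      _ ≤ ∫⁻ a, ENNReal.ofReal (Real.exp (l * (g a - G))) * K ^ n ∂μ := by
          refine lintegral_mono fun a => ?_
          gcongr
          exact ih _ (hsec a)
      _ = (∫⁻ a, ENNReal.ofReal (Real.exp (l * (g a - G))) ∂μ) * K ^ n := by
          rw [lintegral_mul_const' _ _ (by simp [K])]
      _ ≤ K * K ^ n := by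
          gcongr
          exact one_dim μ s V hs hV hmom c hc g hg l hl hlM
      _ = _ := by rw [pow_succ, mul_comm]

lemma one_sided (μ : Measure E) [IsProbabilityMeasure μ]
    (s V : ℝ) (hs : 0 < s) (hV : 0 < V)
    (hmom : ∀ k : ℕ, 2 ≤ k →
      ∫⁻ x, ENNReal.ofReal (‖x‖ ^ k) ∂μ
        ≤ ENNReal.ofReal ((1/2) * s^2 * (Nat.factorial k) * V ^ (k - 2)))
    (c : ℝ) (hc : 0 < c) (n : ℕ) (hn : 0 < n)
    (f : (Fin n → E) → ℝ) (hf : ∀ x y, f x - f y ≤ c * ∑ i, ‖x i - y i‖) (t : ℝ) (ht : 0 < t) :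
    (Measure.pi fun _ : Fin n => μ)
        {x | t ≤ f x - ∫ y, f y ∂(Measure.pi fun _ : Fin n => μ)}
      ≤ ENNReal.ofReal (Real.exp (-(t^2) / (8 * s^2 * (n * c^2) + 4 * V * t * c))) := by
  have hn' : (0:ℝ) < n := by exact_mod_cast hn
  set S := n * (2*s*c)^2 with hS
  set M := 2*V*c with hM
  have hS0 : 0 < S := by positivity
  have hM0 : 0 < M := by positivity
  set l := t / (S + M * t) with hl
  have hl0 : 0 < l := by positivity
  have h1 : 1 - l * M = S / (S + M * t) := by
    rw [hl]; field_simp; ring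
  have hlM : l * M < 1 := by
    have : 0 < S / (S + M * t) := by positivity
    linarith
  have hmg := mgf_bound_s7 μ s V hs hV hmom c hc.le l hl0.le hlM n f hf
  set P := Measure.pi fun _ : Fin n => μ
  set G := ∫ y, f y ∂P
  have hfc := (cont_of_l1 f c hc.le hf).measurable
  have hme : Measurable fun x => ENNReal.ofReal (Real.exp (l * (f x - G))) := by fun_prop
  have hmk := mul_meas_ge_le_lintegral (μ := P) hme (ENNReal.ofReal (Real.exp (l * t)))
  have hsub : P {x | t ≤ f x - G} ≤
      P {x | ENNReal.ofReal (Real.exp (l * t)) ≤ ENNReal.ofReal (Real.exp (l * (f x - G)))} := by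
    refine measure_mono fun x hx => ?_
    simp only [Set.mem_ofPred_eq] at hx ⊢
    gcongr
  have h2 := (mul_le_mul_right hsub (ENNReal.ofReal (Real.exp (l * t)))).trans (hmk.trans hmg)
  rw [← ENNReal.ofReal_pow (Real.exp_pos _).le, ← Real.exp_nat_mul] at h2
  have hexpo : -(t^2) / (8 * s^2 * (n * c^2) + 4 * V * t * c)
      = -(l * t) + n * (l^2 * (2*s*c)^2 / (2 * (1 - l * M))) := by
    have e1 : 8 * s^2 * (n * c^2) + 4 * V * t * c = 2 * (S + M * t) := by
      rw [hS, hM]; ring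
    have e2 : n * (l^2 * (2*s*c)^2 / (2 * (1 - l * M))) = l^2 * S / (2 * (1 - l * M)) := by
      rw [hS]; ring
    rw [e1, e2, h1, hl]
    have : S + M * t ≠ 0 := by positivity
    field_simp
    ring
  rw [hexpo, Real.exp_add, ENNReal.ofReal_mul (Real.exp_pos _).le]
  calc P {x | t ≤ f x - G} = ENNReal.ofReal (Real.exp (-(l*t))) *
        (ENNReal.ofReal (Real.exp (l * t)) * P {x | t ≤ f x - G}) := by
        rw [← mul_assoc, ← ENNReal.ofReal_mul (Real.exp_pos _).le, ← Real.exp_add]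
        simp
    _ ≤ _ := by gcongr
end C

/-- concentration of `W_p(μ̂, μ)` around its mean under a
Bernstein moment condition on `‖X‖`: if the i.i.d. samples satisfy
`E‖X₁‖^k ≤ (1/2) s² k! V^{k−2}` for all integers `k ≥ 2`, then for all `t > 0`,
`P(|W_p(μ̂,μ) − E W_p(μ̂,μ)| ≥ t) ≤ 2 exp(−t²/(8 s² n^{1−2/p} + 4 V t n^{−1/p}))`. -/
theorem wasserstein_concentration_bernstein
    {E : Type*} [NormedAddCommGroup E] [NormedSpace ℝ E] [MeasurableSpace E] [BorelSpace E]
    [SecondCountableTopology E]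
    (p : ℝ) (hp : 1 ≤ p) {n : ℕ} (hn : 0 < n)
    (μ : Measure E) [IsProbabilityMeasure μ]
    (s V : ℝ) (hs : 0 < s) (hV : 0 < V)
    (hmom : ∀ k : ℕ, 2 ≤ k →
      ∫⁻ x, ENNReal.ofReal (‖x‖ ^ k) ∂μ
        ≤ ENNReal.ofReal ((1/2) * s^2 * (Nat.factorial k) * V ^ (k - 2)))
    (t : ℝ) (ht : 0 < t) :
    (Measure.pi fun _ : Fin n => μ)
        {x | t ≤ |wassersteinDist p (empiricalMeasure x) μ
                  - ∫ y, wassersteinDist p (empiricalMeasure y) μ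
                      ∂(Measure.pi fun _ : Fin n => μ)|}
      ≤ ENNReal.ofReal
          (2 * Real.exp (-(t^2) /
            (8 * s^2 * (n:ℝ) ^ ((1:ℝ) - 2/p) + 4 * V * t * (n:ℝ) ^ (-(1/p))))) := by
  have hp0 : 0 < p := by linarith
  have hn' : (0:ℝ) < n := by exact_mod_cast hn
  have hk : ∀ k : ℕ, 2 ≤ k → ∫⁻ x, ENNReal.ofReal (‖x‖ ^ k) ∂μ < ⊤ := fun k hk =>
    (hmom k hk).trans_lt ENNReal.ofReal_lt_top
  set c := (n:ℝ) ^ (-(1/p)) with hc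
  have hc0 : 0 < c := Real.rpow_pos_of_pos hn' _
  have hnc : (n:ℝ) ^ ((1:ℝ) - 2/p) = n * c^2 := by
    rw [hc, ← Real.rpow_natCast, ← Real.rpow_mul hn'.le]
    nth_rewrite 2 [← Real.rpow_one (n:ℝ)]
    rw [← Real.rpow_add hn']
    congr 1
    push_cast
    ring
  rw [hnc]
  set f : (Fin n → E) → ℝ := fun x => wassersteinDist p (empiricalMeasure x) μ with hfdef
  have hf : ∀ x y, f x - f y ≤ c * ∑ i, ‖x i - y i‖ := wass_lip p hp hn μ hk
  have hf' : ∀ x y, (fun x => - f x) x - (fun x => - f x) y ≤ c * ∑ i, ‖x i - y i‖ := by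
    intro x y
    have := hf y x
    simp only [norm_sub_rev (y _)] at this
    simp only
    linarith
  have h1 := one_sided μ s V hs hV hmom c hc0 n hn f hf t ht
  have h2 := one_sided μ s V hs hV hmom c hc0 n hn (fun x => - f x) hf' t ht
  rw [integral_neg] at h2
  rw [two_mul, ENNReal.ofReal_add (Real.exp_pos _).le (Real.exp_pos _).le]
  refine le_trans ?_ (add_le_add h1 h2)
  refine (measure_mono ?_).trans (measure_union_le _ _)
  intro x hx
  simp only [Set.mem_setOf_eq, Set.mem_union] at hx ⊢
  rcases le_abs.1 hx with h | h
  · left; exact h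
  · right; linarith
end
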